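/- Let q be a rational number with 0 < q < 1 and q⁻¹ ∉ ℕ, and let ℕ₀[q] be the positive monoid generated by {qⁿ : n ∈ ℕ₀}. Then ℕ₀[q] is a length-finite factorization monoid (LFFM) that does not satisfy the ascending chain condition on principal ideals (ACCP); in particular, ℕ₀[q] is atomic with set of atoms exactly {qⁿ : n ∈ ℕ₀}, and for every n ∈ ℕ₀ one has d(q)·qⁿ = (d(q) − n(q))·qⁿ + d(q)·q^{n+1}, where n(q) and d(q) denote the numerator and denominator of q in lowest terms. -/

import Mathlib

/-- `a` is an (additive) atom of the set `M ⊆ ℝ`. -/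
def IsAddAtom (M : Set ℝ) (a : ℝ) : Prop :=
  a ∈ M ∧ a ≠ 0 ∧ ∀ b ∈ M, ∀ c ∈ M, a = b + c → b = 0 ∨ c = 0

/-- The factorizations of `x` in `M`: multisets of atoms of `M` summing to `x`. -/
def AddFactorizations (M : Set ℝ) (x : ℝ) : Set (Multiset ℝ) :=
  {s | (∀ a ∈ s, IsAddAtom M a) ∧ s.sum = x}

/-- `M` is atomic: every nonzero element has a factorization into atoms. -/
def IsAddAtomic (M : Set ℝ) : Prop :=
  ∀ x ∈ M, x ≠ 0 → (AddFactorizations M x).Nonempty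

/-- `M` is a length-finite factorization monoid: it is atomic, and every element has
only finitely many factorizations of each fixed length. -/
def IsLFFM (M : Set ℝ) : Prop :=
  IsAddAtomic M ∧
    ∀ x ∈ M, ∀ ℓ : ℕ, {s ∈ AddFactorizations M x | Multiset.card s = ℓ}.Finite

/-- A sum of powers of `r ∈ (0, 1)` is either at least `r ^ n`, or a sum of powers with
exponents exceeding `n`; if `r = a / d`, the numerator of the latter is divisible by
`a ^ (n + 1)`. -/
theorem pow_le_or_exists_mul_pow_eq_of_mem_closure {r : ℝ} (hr0 : 0 < r) (hr1 : r < 1) {a d : ℕ}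
    (had : r * d = a) (n : ℕ) {x : ℝ}
    (hx : x ∈ AddSubmonoid.closure (Set.range fun n : ℕ => r ^ n)) :
    0 ≤ x ∧ (r ^ n ≤ x ∨ ∃ N k : ℕ, x * (d : ℝ) ^ N = (a : ℝ) ^ (n + 1) * k) := by
  induction hx using AddSubmonoid.closure_induction with
  | mem x hx =>
    obtain ⟨i, rfl⟩ := hx
    refine ⟨by positivity, ?_⟩
    rcases le_or_gt i n with h | h
    · exact Or.inl (pow_le_pow_of_le_one hr0.le hr1.le h)
    · refine Or.inr ⟨i, a ^ (i - (n + 1)), ?_⟩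
      push_cast
      rw [← mul_pow, had, ← pow_add]
      congr 1
      omega
  | zero => exact ⟨le_rfl, Or.inr ⟨0, 0, by simp⟩⟩
  | add x y _ _ hx hy =>
    obtain ⟨hx0, hx⟩ := hx
    obtain ⟨hy0, hy⟩ := hy
    refine ⟨add_nonneg hx0 hy0, ?_⟩
    rcases hx with hx | ⟨N, k, hk⟩
    · left; linarith
    rcases hy with hy | ⟨N', k', hk'⟩
    · left; linarith
    refine Or.inr ⟨N + N', k * d ^ N' + k' * d ^ N, ?_⟩
    push_cast
    rw [pow_add]
    linear_combination (d : ℝ) ^ N' * hk + (d : ℝ) ^ N * hk'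

/-- For `r = a / d` in lowest terms with `0 < r < 1` and `a ≠ 1`, every power of `r` is an atom of
the monoid generated by the powers of `r`. -/
theorem isAddAtom_pow {r : ℝ} (hr0 : 0 < r) (hr1 : r < 1) {a d : ℕ} (had : r * d = a)
    (hcop : Nat.Coprime a d) (ha : a ≠ 1) (n : ℕ) :
    IsAddAtom (AddSubmonoid.closure (Set.range fun n : ℕ => r ^ n) : Set ℝ) (r ^ n) := by
  refine ⟨AddSubmonoid.subset_closure ⟨n, rfl⟩, by positivity, fun b hb c hc h => ?_⟩
  obtain ⟨hb0, hb⟩ := pow_le_or_exists_mul_pow_eq_of_mem_closure hr0 hr1 had n hb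
  obtain ⟨hc0, hc⟩ := pow_le_or_exists_mul_pow_eq_of_mem_closure hr0 hr1 had n hc
  rcases hb with hb | ⟨N, k, hk⟩
  · right; linarith
  rcases hc with hc | ⟨N', k', hk'⟩
  · left; linarith
  exfalso
  have hd : (d : ℝ) ≠ 0 := by
    intro hd
    have hd' : d = 0 := by exact_mod_cast hd
    subst hd'
    exact ha (by simpa using hcop)
  have ha0 : (a : ℝ) ≠ 0 := had ▸ mul_ne_zero hr0.ne' hd
  have hrn : r ^ n * (d : ℝ) ^ n = (a : ℝ) ^ n := by rw [← mul_pow, had]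
  have key : (d : ℝ) ^ (N + N') = a * ((k * d ^ N' + k' * d ^ N) * d ^ n) := by
    refine mul_left_cancel₀ (pow_ne_zero n ha0) ?_
    rw [← hrn, h, pow_add]
    rw [h] at hrn
    linear_combination (d : ℝ) ^ N' * d ^ n * hk + (d : ℝ) ^ N * d ^ n * hk' -
      a * ((k * d ^ N' + k' * d ^ N) * d ^ n) * hrn
  have key' : d ^ (N + N') = a * ((k * d ^ N' + k' * d ^ N) * d ^ n) := by exact_mod_cast key
  exact ha ((hcop.pow_right (N + N')).eq_one_of_dvd ⟨_, key'⟩)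

/-- An atom of a monoid belongs to every generating set. -/
theorem IsAddAtom.mem_of_closure {S : Set ℝ} {x : ℝ}
    (hx : IsAddAtom (AddSubmonoid.closure S : Set ℝ) x) : x ∈ S := by
  have hmem : x ∈ AddSubmonoid.closure S := hx.1
  induction hmem using AddSubmonoid.closure_induction with
  | mem x h => exact h
  | zero => exact absurd rfl hx.2.1
  | add y z hy hz ihy ihz =>
    rcases hx.2.2 y hy z hz rfl with h | h
    · subst h
      rw [zero_add] at hx ⊢
      exact ihz hx
    · subst h
      rw [add_zero] at hx ⊢
      exact ihy hx

/-- A real number has only finitely many representations as a sum of `ℓ` powers of `r ∈ (0, 1)`. -/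
theorem finite_multiset_pow_sum_eq {r : ℝ} (hr0 : 0 < r) (hr1 : r < 1) (ℓ : ℕ) (x : ℝ) :
    {s : Multiset ℝ | (∀ a ∈ s, a ∈ Set.range fun n : ℕ => r ^ n) ∧ s.sum = x ∧
      Multiset.card s = ℓ}.Finite := by
  induction ℓ generalizing x with
  | zero =>
    refine (Set.finite_singleton (0 : Multiset ℝ)).subset ?_
    rintro s ⟨-, -, hs⟩
    simpa using hs
  | succ ℓ ih =>
    rcases le_or_gt x 0 with hx | hx
    · refine Set.finite_empty.subset ?_
      rintro s ⟨hs, hsum, hcard⟩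
      obtain ⟨a, ha⟩ := (Multiset.card_pos_iff_exists_mem (s := s)).1 (by omega)
      obtain ⟨t, rfl⟩ := Multiset.exists_cons_of_mem ha
      have ht : 0 ≤ t.sum := Multiset.sum_nonneg fun b hb => by
        obtain ⟨n, rfl⟩ := hs b (Multiset.mem_cons_of_mem hb)
        positivity
      obtain ⟨n, rfl⟩ := hs a (Multiset.mem_cons_self a t)
      rw [Multiset.sum_cons] at hsum
      have : 0 < r ^ n := by positivity
      simp only at hsum
      linarith
    · obtain ⟨N, hN⟩ := exists_pow_lt_of_lt_one (show 0 < x / (ℓ + 1 : ℕ) by positivity) hr1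
      refine ((Set.finite_lt_nat N).biUnion fun n _ =>
        (ih (x - r ^ n)).image fun t => r ^ n ::ₘ t).subset ?_
      rintro s ⟨hs, hsum, hcard⟩
      obtain ⟨a, ha, hxa⟩ : ∃ a ∈ s, x / (ℓ + 1 : ℕ) ≤ a := by
        by_contra! hlt
        have hne : s ≠ 0 := by
          rintro rfl
          simp at hcard
        have : s.sum < (s.map fun _ => x / ((ℓ + 1 : ℕ) : ℝ)).sum := by
          simpa using Multiset.sum_lt_sum_of_nonempty (f := id) hne hlt
        rw [hsum, Multiset.map_const', Multiset.sum_replicate, hcard, nsmul_eq_mul,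
          mul_div_cancel₀ _ (by positivity)] at this
        exact lt_irrefl _ this
      obtain ⟨n, rfl⟩ := hs a ha
      obtain ⟨t, rfl⟩ := Multiset.exists_cons_of_mem ha
      have hn : n < N := (pow_lt_pow_iff_right_of_lt_one₀ hr0 hr1).1 (hN.trans_le hxa)
      refine Set.mem_biUnion (show n ∈ {i | i < N} from hn) ⟨t, ⟨fun b hb =>
        hs b (Multiset.mem_cons_of_mem hb), ?_, by simpa using hcard⟩, rfl⟩
      rw [Multiset.sum_cons] at hsum
      simp only at hsum
      linarith

/-- For rational `0 < q < 1` with `q⁻¹ ∉ ℕ`, the positive monoid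
`ℕ₀[q] = ⟨qⁿ : n ∈ ℕ₀⟩` is an LFFM that does not satisfy the ACCP; in particular,
its set of atoms is exactly `{qⁿ : n ∈ ℕ₀}`, and
`d(q)·qⁿ = (d(q) − n(q))·qⁿ + d(q)·q^{n+1}` for every `n`. -/
theorem rational_cyclic_monoid_isLFFM_not_ACCP
    (q : ℚ) (hq0 : 0 < q) (hq1 : q < 1) (hqinv : ∀ n : ℕ, q⁻¹ ≠ (n : ℚ))
    (M : AddSubmonoid ℝ)
    (hgen : M = AddSubmonoid.closure (Set.range fun n : ℕ => (q : ℝ) ^ n)) :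
    IsLFFM (M : Set ℝ) ∧
    IsAddAtomic (M : Set ℝ) ∧
    {x : ℝ | IsAddAtom (M : Set ℝ) x} = Set.range (fun n : ℕ => (q : ℝ) ^ n) ∧
    (∀ n : ℕ, (q.den : ℝ) * (q : ℝ) ^ n =
      ((q.den : ℝ) - (q.num : ℝ)) * (q : ℝ) ^ n + (q.den : ℝ) * (q : ℝ) ^ (n + 1)) ∧
    ∃ b : ℕ → ℝ, (∀ n, b n ∈ M) ∧
      (∀ n : ℕ, (fun y => b n + y) '' (M : Set ℝ) ⊆
        (fun y => b (n + 1) + y) '' (M : Set ℝ)) ∧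
      ¬ ∃ N : ℕ, ∀ n ≥ N, (fun y => b n + y) '' (M : Set ℝ) =
        (fun y => b N + y) '' (M : Set ℝ) := by
  subst hgen
  set r : ℝ := (q : ℝ) with hr
  have hr0 : 0 < r := Rat.cast_pos.2 hq0
  have hr1 : r < 1 := by rw [hr]; exact_mod_cast hq1
  have hnum : 0 < q.num := Rat.num_pos.2 hq0
  have hcast : ((q.num.natAbs : ℕ) : ℝ) = (q.num : ℝ) := by
    rw [← Int.cast_natCast, Int.natAbs_of_nonneg hnum.le]
  have hnd : r * q.den = q.num := by
    rw [hr]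
    exact_mod_cast Rat.mul_den_eq_num q
  have had : r * q.den = (q.num.natAbs : ℕ) := by rw [hnd, hcast]
  have ha : q.num.natAbs ≠ 1 := by
    intro h
    refine hqinv q.den ?_
    have h1 : q.num = 1 := by omega
    have h2 := Rat.mul_den_eq_num q
    rw [h1, Int.cast_one] at h2
    exact inv_eq_of_mul_eq_one_right h2
  have hatom := isAddAtom_pow hr0 hr1 had q.reduced ha
  have hd : (0 : ℝ) < q.den := by exact_mod_cast q.den_pos
  have hlt : q.num.natAbs ≤ q.den := by
    have : (q.num.natAbs : ℝ) ≤ q.den := by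
      rw [← had]
      exact mul_le_of_le_one_left hd.le hr1.le
    exact_mod_cast this
  have hid : ∀ n : ℕ, (q.den : ℝ) * r ^ n =
      ((q.den : ℝ) - (q.num : ℝ)) * r ^ n + (q.den : ℝ) * r ^ (n + 1) := by
    intro n
    rw [← hnd]
    ring
  have hatomic : IsAddAtomic
      (AddSubmonoid.closure (Set.range fun n : ℕ => r ^ n) : Set ℝ) := by
    intro x hx _
    obtain ⟨s, hs, hsum⟩ := AddSubmonoid.exists_multiset_of_mem_closure hx
    refine ⟨s, fun a ha => ?_, hsum⟩
    obtain ⟨n, rfl⟩ := hs a ha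
    exact hatom n
  have hmem : ∀ m n : ℕ, (m : ℝ) * r ^ n ∈
      AddSubmonoid.closure (Set.range fun n : ℕ => r ^ n) := fun m n => by
    rw [← nsmul_eq_mul]
    exact nsmul_mem (AddSubmonoid.subset_closure (Set.mem_range_self n)) m
  refine ⟨⟨hatomic, fun x _ ℓ => ?_⟩, hatomic, ?_, hid,
    fun n => q.den * r ^ n, hmem q.den, fun n => ?_, ?_⟩
  · refine (finite_multiset_pow_sum_eq hr0 hr1 ℓ x).subset ?_
    rintro s ⟨⟨hs, hsum⟩, hcard⟩
    exact ⟨fun a ha => (hs a ha).mem_of_closure, hsum, hcard⟩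
  · ext x
    refine ⟨fun hx => hx.mem_of_closure, ?_⟩
    rintro ⟨n, rfl⟩
    exact hatom n
  · rintro _ ⟨y, hy, rfl⟩
    refine ⟨(q.den - q.num.natAbs : ℕ) * r ^ n + y, add_mem (hmem _ n) hy, ?_⟩
    simp only
    rw [Nat.cast_sub hlt, hcast, hid n]
    ring
  · rintro ⟨N, hN⟩
    have h : (q.den : ℝ) * r ^ (N + 1) ∈ (fun y => (q.den : ℝ) * r ^ N + y) ''
        (AddSubmonoid.closure (Set.range fun n : ℕ => r ^ n) : Set ℝ) := by
      rw [← hN (N + 1) (Nat.le_succ N)]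
      exact ⟨0, zero_mem (AddSubmonoid.closure _), add_zero _⟩
    obtain ⟨y, hy, h⟩ := h
    have hy0 := (pow_le_or_exists_mul_pow_eq_of_mem_closure hr0 hr1 had 0 hy).1
    have hpow : r ^ (N + 1) < r ^ N := pow_lt_pow_right_of_lt_one₀ hr0 hr1 (Nat.lt_succ_self N)
    have := mul_lt_mul_of_pos_left hpow hd
    simp only at h
    linarith
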